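/- Let K be a subcomplex of I^n, let k ≥ 1, and let S ⊆ K be a subcomplex that is isomorphic to ∂I^{k+1}. Then there exists a (k+1)-dimensional face F of I^n (not necessarily belonging to K) such that S = ∂F̂. -/

import Mathlib

/-- A face of the cube `I^n`: `none` marks a free coordinate. -/
def CubeFace (n : ℕ) : Type := Fin n → Option Bool

namespace CubeFace

/-- The order on faces of the cube: `F ≤ G` iff every coordinate of `G` is free
or agrees with the corresponding coordinate of `F`. -/
instance (n : ℕ) : PartialOrder (CubeFace n) where
  le F G := ∀ i, G i = none ∨ F i = G i
  le_refl F i := Or.inr rfl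
  le_trans F G H h1 h2 i := by
    rcases h2 i with h | h
    · exact Or.inl h
    · rcases h1 i with h' | h'
      · exact Or.inl (h ▸ h')
      · exact Or.inr (h' ▸ h)
  le_antisymm F G h1 h2 := by
    funext i
    rcases h1 i with h | h
    · rcases h2 i with h' | h'
      · rw [h, h']
      · rw [← h', h]
    · exact h

/-- The face of `I^n` corresponding to a vertex. -/
def toFace {n : ℕ} (v : Fin n → Bool) : CubeFace n := fun i => some (v i)

/-- The vertex set of a face. -/
def verts {n : ℕ} (F : CubeFace n) : Set (Fin n → Bool) := {v | toFace v ≤ F}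

/-- The dimension of a face: its number of free coordinates. -/
def dim {n : ℕ} (F : CubeFace n) : ℕ :=
  haveI : DecidablePred (fun i : Fin n => F i = none) :=
    fun i => (inferInstance : DecidableEq (Option Bool)) (F i) none
  (Finset.univ.filter (fun i => F i = none)).card

/-- A subcomplex of `I^n`: a nonempty, downward closed set of faces. -/
def IsSubcomplex {n : ℕ} (K : Set (CubeFace n)) : Prop :=
  K.Nonempty ∧ ∀ F ∈ K, ∀ G : CubeFace n, G ≤ F → G ∈ K

/-- The vertex set of a subcomplex. -/
def cvert {n : ℕ} (K : Set (CubeFace n)) : Set (Fin n → Bool) := {v | toFace v ∈ K}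

/-- A subcomplex `Γ ⊆ K` is face-like if, for every face `F` of `K`, the set of vertices
of `F` belonging to `Γ` is empty or the vertex set of a face of `Γ`. -/
def FaceLike {n : ℕ} (K Γ : Set (CubeFace n)) : Prop :=
  ∀ F ∈ K, verts F ∩ cvert Γ = ∅ ∨ ∃ G ∈ Γ, verts F ∩ cvert Γ = verts G

/-- The deletion `K ∖ Γ`: the faces of `K` with no vertex in `Γ`. -/
def delete {n : ℕ} (K Γ : Set (CubeFace n)) : Set (CubeFace n) :=
  {F | F ∈ K ∧ verts F ∩ cvert Γ = ∅}

/-- The geometric realization of a subcomplex of `I^n`, as a subset of `ℝ^n`. -/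
def real {n : ℕ} (K : Set (CubeFace n)) : Set (Fin n → ℝ) :=
  ⋃ F ∈ K, {x | (∀ i, 0 ≤ x i ∧ x i ≤ 1) ∧
    ∀ i, (F i = some false → x i = 0) ∧ (F i = some true → x i = 1)}

/-- The boundary `∂F̂` of a face `F`: all faces strictly below `F`. -/
def bdryHat {n : ℕ} (F : CubeFace n) : Set (CubeFace n) := {G | G ≤ F ∧ G ≠ F}

/-- The boundary of the cube `I^k`: all faces except the top one. -/
def boundaryCube (k : ℕ) : Set (CubeFace k) := {F | F ≠ fun _ => none}

/-- The `k`-skeleton of a subcomplex. -/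
def skel {n : ℕ} (k : ℕ) (K : Set (CubeFace n)) : Set (CubeFace n) :=
  {F | F ∈ K ∧ dim F ≤ k}

/-- Isomorphism of cubical subcomplexes: a bijection between the vertex sets under which
vertex sets of faces correspond to vertex sets of faces. -/
def Iso {m n : ℕ} (K : Set (CubeFace m)) (L : Set (CubeFace n)) : Prop :=
  ∃ f : (Fin m → Bool) → (Fin n → Bool),
    Set.BijOn f (cvert K) (cvert L) ∧
    ∀ W : Set (Fin m → Bool), W ⊆ cvert K →
      ((∃ F ∈ K, verts F = W) ↔ (∃ G ∈ L, verts G = f '' W))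

/-- `K` has dimension `d`. -/
def HasDim {n : ℕ} (K : Set (CubeFace n)) (d : ℕ) : Prop :=
  (∀ F ∈ K, dim F ≤ d) ∧ ∃ F ∈ K, dim F = d

end CubeFace

namespace CubeFace

theorem mem_verts {n : ℕ} {F : CubeFace n} {v : Fin n → Bool} :
    v ∈ verts F ↔ ∀ i, F i = none ∨ some (v i) = F i := Iff.rfl

theorem le_of_verts {n : ℕ} {F H : CubeFace n} (h : verts F ⊆ verts H) : F ≤ H := by
  intro i
  rcases hi : H i with _ | b
  · exact Or.inl rfl
  · right
    have hv : (fun l => (F l).getD (!b)) ∈ verts F := by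
      rw [mem_verts]
      intro l
      rcases hl : F l with _ | c <;> simp [hl]
    have := mem_verts.1 (h hv) i
    rw [hi] at this
    rcases hl : F i with _ | c <;> simp [hl] at this ⊢
    exact this

theorem verts_inj {n : ℕ} {F H : CubeFace n} (h : verts F = verts H) : F = H :=
  le_antisymm (le_of_verts h.le) (le_of_verts h.ge)

theorem verts_mono {n : ℕ} {F H : CubeFace n} (h : F ≤ H) : verts F ⊆ verts H :=
  fun _ hv => le_trans (show _ ≤ F from hv) h

/-- flip one coordinate -/
def flip {n : ℕ} (v : Fin n → Bool) (i : Fin n) : Fin n → Bool :=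
  fun l => if l = i then !(v l) else v l

theorem flip_flip {n : ℕ} (v : Fin n → Bool) (i : Fin n) : flip (flip v i) i = v := by
  funext l
  by_cases h : l = i <;> simp [flip, h]

theorem flip_comm {n : ℕ} (v : Fin n → Bool) (i j : Fin n) :
    flip (flip v i) j = flip (flip v j) i := by
  funext l
  simp only [flip]
  split_ifs <;> rfl

theorem flip_ne {n : ℕ} (v : Fin n → Bool) (i : Fin n) : flip v i ≠ v := by
  intro h
  have := congrFun h i
  simp [flip] at this

theorem flip_inj {n : ℕ} {v : Fin n → Bool} {i j : Fin n} (h : flip v i = flip v j) : i = j := by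
  by_contra hij
  have := congrFun h i
  simp [flip, hij] at this

theorem flip_cross {n : ℕ} {a : Fin n → Bool} {p q r s : Fin n}
    (h : flip (flip a q) r = flip (flip a p) s) (hpq : p ≠ q) (hne : flip (flip a q) r ≠ a) :
    r = p := by
  by_contra hrp
  have hrq : r ≠ q := by
    rintro rfl
    exact hne (flip_flip a r)
  have h1 := congrFun h p
  have h2 := congrFun h q
  have h3 := congrFun h r
  simp only [flip] at h1 h2 h3
  have e1 : p ≠ r := fun e => hrp e.symm
  have e2 : q ≠ r := fun e => hrq e.symm
  have e3 : q ≠ p := fun e => hpq e.symm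
  simp [hpq, hrp, hrq, e1, e2, e3] at h1 h2 h3
  exact hrq (h3.trans h2.symm)

theorem flip_induction {m : ℕ} {P : (Fin m → Bool) → Prop} (h0 : P fun _ => false)
    (hs : ∀ v i, P v → P (flip v i)) (v : Fin m → Bool) : P v := by
  have key : ∀ s : Finset (Fin m), P (fun l => decide (l ∈ s)) := by
    intro s
    induction s using Finset.induction_on with
    | empty => simpa using h0
    | insert a s ha ih =>
      convert hs _ a ih using 1
      funext l
      by_cases h : l = a
      · subst h; simp [flip, ha]
      · simp [flip, h]
  convert key (Finset.univ.filter fun l => v l = true) using 1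
  funext l
  simp

theorem exists_dir {m n : ℕ} (g : (Fin m → Bool) → (Fin n → Bool)) (hg : Function.Injective g)
    (he : ∀ v i, ∃ j, g (flip v i) = flip (g v) j) :
    ∃ d : Fin m → Fin n, Function.Injective d ∧ ∀ v i, g (flip v i) = flip (g v) (d i) := by
  choose D hD using he
  have step : ∀ v j i, D (flip v j) i = D v i := by
    intro v j i
    by_cases hij : i = j
    · subst hij
      have h := hD (flip v i) i
      rw [flip_flip, hD v i] at h
      apply flip_inj (v := flip (g v) (D v i))
      rw [← h, flip_flip]
    · apply flip_cross (a := g v) (q := D v j) (s := D (flip v i) j)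
      · rw [← hD, ← hD, ← hD, ← hD, flip_comm]
      · intro h
        exact hij (flip_inj (hg ((hD v i).trans (h ▸ (hD v j).symm))))
      · rw [← hD, ← hD]
        intro h
        have := hg h
        apply hij
        apply flip_inj (v := flip v j)
        rw [this, flip_flip]
  have const : ∀ v i, D v i = D (fun _ => false) i := by
    intro v
    induction v using flip_induction with
    | h0 => intro i; rfl
    | hs v j ih => intro i; rw [step, ih]
  refine ⟨D fun _ => false, ?_, fun v i => by rw [hD, const]⟩
  intro i j h
  apply flip_inj (v := fun _ => false)
  apply hg
  rw [hD, hD, h]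

theorem dir_formula {m n : ℕ} (g : (Fin m → Bool) → (Fin n → Bool)) (d : Fin m → Fin n)
    (hd : Function.Injective d) (h : ∀ v i, g (flip v i) = flip (g v) (d i)) (v : Fin m → Bool) :
    (∀ i, g v (d i) = xor (g (fun _ => false) (d i)) (v i)) ∧
    ∀ l, (∀ i, d i ≠ l) → g v l = g (fun _ => false) l := by
  induction v using flip_induction with
  | h0 => simp
  | hs v j ih =>
    rw [h]
    refine ⟨fun i => ?_, fun l hl => ?_⟩
    · by_cases hij : i = j
      · subst hij; simp [flip, ih.1]
      · have : d i ≠ d j := fun e => hij (hd e)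
        simp [flip, hij, this, ih.1]
    · have : l ≠ d j := fun e => hl j e.symm
      simp [flip, this, ih.2 l hl]

theorem edge_flip {n : ℕ} {H : CubeFace n} {a b : Fin n → Bool} (hab : a ≠ b)
    (h : verts H = {a, b}) : ∃ j, b = flip a j := by
  obtain ⟨p, hp⟩ := Function.ne_iff.1 hab
  have ha := mem_verts.1 (show a ∈ verts H by simp [h])
  have hb := mem_verts.1 (show b ∈ verts H by simp [h])
  have hn : H p = none := by
    rcases ha p with h1 | h1
    · exact h1
    · rcases hb p with h2 | h2
      · exact h2
      · exact absurd (Option.some.inj (h1.trans h2.symm)) hp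
  have hf : flip a p ∈ verts H := by
    rw [mem_verts]
    intro l
    by_cases hl : l = p
    · subst hl; exact Or.inl hn
    · simpa [flip, hl] using ha l
  rw [h] at hf
  rcases hf with hf | hf
  · exact absurd hf (flip_ne a p)
  · exact ⟨p, (Set.mem_singleton_iff.1 hf).symm⟩

/-- the edge at `v` in direction `i` -/
def edgeFace {m : ℕ} (v : Fin m → Bool) (i : Fin m) : CubeFace m :=
  fun l => if l = i then none else some (v l)

theorem verts_edge {m : ℕ} (v : Fin m → Bool) (i : Fin m) :
    verts (edgeFace v i) = {v, flip v i} := by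
  ext w
  rw [mem_verts]
  constructor
  · intro h
    have h' : ∀ l, l ≠ i → w l = v l := fun l hl => by simpa [edgeFace, hl] using h l
    by_cases hw : w i = v i
    · left
      funext l
      by_cases hl : l = i
      · subst hl; exact hw
      · exact h' l hl
    · right
      funext l
      by_cases hl : l = i
      · subst hl; simpa [flip] using Bool.eq_not_of_ne hw
      · simpa [flip, hl] using h' l hl
  · rintro (rfl | rfl) l <;> by_cases hl : l = i <;> simp [edgeFace, flip, hl]

end CubeFace

open CubeFace in
/-- a subcomplex `S ≅ ∂I^{k+1}` of a subcomplex of `I^n` (`k ≥ 1`) is the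
boundary `∂F̂` of some `(k+1)`-dimensional face `F` of `I^n`. -/
theorem sphere_subcomplex_is_boundary_of_cube_face
    {n k : ℕ} (hk : 1 ≤ k) (K : Set (CubeFace n)) (hK : IsSubcomplex K)
    (S : Set (CubeFace n)) (hS : IsSubcomplex S) (hSK : S ⊆ K)
    (hiso : Iso S (boundaryCube (k + 1))) :
    ∃ F : CubeFace n, dim F = k + 1 ∧ S = bdryHat F := by
  classical
  obtain ⟨f, hf, hW⟩ := hiso
  have huniv : ∀ v, v ∈ cvert (boundaryCube (k + 1)) := by
    intro v h
    have := congrFun h 0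
    simp [toFace] at this
  have hex : ∀ v, ∃ u, u ∈ cvert S ∧ f u = v := fun v => hf.surjOn (huniv v)
  choose g hgS hfg using hex
  have hg : Function.Injective g := fun a b h => by rw [← hfg a, ← hfg b, h]
  have hgf : ∀ u ∈ cvert S, g (f u) = u := fun u hu => hf.injOn (hgS _) hu (hfg _)
  have hsub : ∀ H ∈ S, verts H ⊆ cvert S := fun H hH v hv => hS.2 H hH _ hv
  have lift : ∀ G ∈ boundaryCube (k + 1), ∃ H ∈ S, verts H = g '' verts G := by
    intro G hG
    refine (hW (g '' verts G) ?_).2 ⟨G, hG, ?_⟩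
    · rintro _ ⟨v, -, rfl⟩; exact hgS v
    · simp [Set.image_image, hfg]
  obtain ⟨d, hd, hgd⟩ := exists_dir g hg (by
    intro v i
    obtain ⟨H, -, hH⟩ := lift (edgeFace v i) (by
      intro h
      have : Nontrivial (Fin (k + 1)) := Fin.nontrivial_iff_two_le.2 (by omega)
      obtain ⟨j, hj⟩ := exists_ne i
      have := congrFun h j
      simp [edgeFace, hj] at this)
    rw [verts_edge, Set.image_pair] at hH
    exact edge_flip (fun h => flip_ne v i (hg h).symm) hH)
  have hform := dir_formula g d hd hgd
  set g0 := g (fun _ => false) with hg0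
  let F : CubeFace n := fun l => if ∃ i, d i = l then none else some (g0 l)
  have hFd : ∀ i, F (d i) = none := fun i => if_pos ⟨i, rfl⟩
  have hFn : ∀ l, (∀ i, d i ≠ l) → F l = some (g0 l) := fun l hl =>
    if_neg (by rintro ⟨i, hi⟩; exact hl i hi)
  have hgF : ∀ v, g v ∈ verts F := by
    intro v
    rw [mem_verts]
    intro l
    by_cases hl : ∃ i, d i = l
    · exact Or.inl (if_pos hl)
    · push Not at hl
      right; rw [hFn l hl, (hform v).2 l hl]
  have hFg : ∀ u ∈ verts F, ∃ v, g v = u := by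
    intro u hu
    refine ⟨fun i => xor (g0 (d i)) (u (d i)), ?_⟩
    funext l
    by_cases hl : ∃ i, d i = l
    · obtain ⟨i, rfl⟩ := hl
      rw [(hform _).1]; simp
    · push Not at hl
      rw [(hform _).2 l hl]
      have := mem_verts.1 hu l
      rw [hFn l hl] at this
      have h3 : u l = g0 l := by simpa using this
      exact h3.symm
  refine ⟨F, ?_, ?_⟩
  · unfold dim
    have : (Finset.univ.filter (fun l => F l = none)) = Finset.univ.image d := by
      ext l
      simp only [Finset.mem_filter, Finset.mem_univ, true_and, Finset.mem_image]
      by_cases hl : ∃ i, d i = l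
      · simp [hl, F]
      · simp [hl, F]
    have h2 := Finset.card_image_of_injective Finset.univ hd
    rw [← this] at h2
    simp only [Finset.card_univ, Fintype.card_fin] at h2
    rw [← h2]
  · ext H
    constructor
    · intro hH
      refine ⟨le_of_verts fun u hu => ?_, ?_⟩
      · rw [← hgf u (hsub H hH hu)]; exact hgF _
      · rintro rfl
        obtain ⟨G, hG, hGe⟩ := (hW (verts F) (hsub F hH)).1 ⟨F, hH, rfl⟩
        apply hG
        apply verts_inj
        rw [hGe]
        ext v
        constructor
        · intro _; exact fun _ => Or.inl rfl
        · intro _; exact ⟨g v, hgF v, hfg v⟩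
    · rintro ⟨hle, hne⟩
      let G : CubeFace (k + 1) := fun i => (H (d i)).map (fun b => xor (g0 (d i)) b)
      have hHn : ∀ l, (∀ i, d i ≠ l) → H l = some (g0 l) := by
        intro l hl
        have := hle l
        rw [hFn l hl] at this
        simpa using this
      have hGv : ∀ v, v ∈ verts G ↔ g v ∈ verts H := by
        intro v
        rw [mem_verts, mem_verts]
        have key : ∀ i, (G i = none ∨ some (v i) = G i) ↔
            (H (d i) = none ∨ some (g v (d i)) = H (d i)) := by
          intro i
          rw [(hform v).1 i]
          rcases hi : H (d i) with _ | b
          · simp [G, hi]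
          · simp only [G, hi, Option.map_some, Option.some.injEq, reduceCtorEq, false_or]
            cases b <;> cases g0 (d i) <;> cases v i <;> simp
        constructor
        · intro h l
          by_cases hl : ∃ i, d i = l
          · obtain ⟨i, rfl⟩ := hl
            exact (key i).1 (h i)
          · push Not at hl
            right; rw [hHn l hl, (hform v).2 l hl]
        · intro h i
          exact (key i).2 (h (d i))
      obtain ⟨H', hH', hv⟩ := lift G (by
        intro hG
        apply hne
        apply le_antisymm hle
        apply le_of_verts
        intro u hu
        obtain ⟨v, rfl⟩ := hFg u hu
        rw [← hGv, hG]
        exact fun _ => Or.inl rfl)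
      have : H = H' := by
        apply verts_inj
        rw [hv]
        ext u
        constructor
        · intro hu
          obtain ⟨v, rfl⟩ := hFg u (verts_mono hle hu)
          exact ⟨v, (hGv v).2 hu, rfl⟩
        · rintro ⟨v, hvG, rfl⟩
          exact (hGv v).1 hvG
      exact this ▸ hH'
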